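/- Let κ > 0 and let f : [0,∞) → [0,∞) be a κ-function. Then for any finite-dimensional complex Hilbert space ℋ, the function (α, z, ρ, σ) ↦ D_{α,z}(ρ‖σ) is continuous on the set {(α,z) ∈ (1,∞) × (0,∞) : (1−κ)α < 1 and (α−1)/κ < z} × {(ρ,σ) : ρ, σ nonzero PSD operators on ℋ with ρ ≤ f(σ)}. -/

import Mathlib

open Filter Set Topology
open scoped ComplexOrder

noncomputable section

namespace QRenyi

attribute [local instance] Classical.propDecidable

variable {ι : Type*} [Fintype ι] [DecidableEq ι]

/-- Apply a real function to the eigenvalues of a Hermitian matrix (functional calculus);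
junk value `0` for non-Hermitian matrices. -/
noncomputable def hermApply (f : ℝ → ℝ) (A : Matrix ι ι ℂ) : Matrix ι ι ℂ :=
  if hA : A.IsHermitian then hA.cfc f else 0

/-- Real power of a positive semidefinite matrix, taken on its support:
`t ↦ t ^ x` is applied to the nonzero eigenvalues and `0` is mapped to `0`.
In particular `matPow A 0` is the support projection of `A`. -/
noncomputable def matPow (A : Matrix ι ι ℂ) (x : ℝ) : Matrix ι ι ℂ :=
  hermApply (fun t => if t = 0 then 0 else t ^ x) A

/-- Logarithm of a positive semidefinite matrix taken on its support
(`Real.log 0 = 0` in Mathlib, matching the convention `log̃ 0 = 0`). -/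
noncomputable def matLog (A : Matrix ι ι ℂ) : Matrix ι ι ℂ :=
  hermApply Real.log A

/-- `supp ρ ≤ supp σ`, expressed (for PSD matrices) as inclusion of kernels. -/
def suppLE (ρ σ : Matrix ι ι ℂ) : Prop :=
  ∀ v : ι → ℂ, σ.mulVec v = 0 → ρ.mulVec v = 0

/-- The Loewner (positive semidefinite) order. -/
def loewnerLE (A B : Matrix ι ι ℂ) : Prop := (B - A).PosSemidef

/-- Real part of the trace. -/
noncomputable def reTrace (A : Matrix ι ι ℂ) : ℝ := A.trace.re

/-- The trace quantity `Tr ((σ^{(1-α)/(2z)} ρ^{α/z} σ^{(1-α)/(2z)})^z)` (a real number). -/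
noncomputable def Qaz (α z : ℝ) (ρ σ : Matrix ι ι ℂ) : ℝ :=
  reTrace (matPow (matPow σ ((1 - α) / (2 * z)) * matPow ρ (α / z) *
    matPow σ ((1 - α) / (2 * z))) z)

/-- The Rényi `(α,z)`-divergence (for `α ≠ 1`), with values in `EReal = ℝ ∪ {±∞}`.
It equals `(α-1)⁻¹ (log Q_{α,z}(ρ‖σ) - log Tr ρ)`; it is `+∞` when `α > 1` and
`supp ρ ≰ supp σ`, and also `+∞` when `α < 1` and `Q_{α,z}(ρ‖σ) = 0`
(i.e. `(α-1)⁻¹ log 0 = +∞`). -/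
noncomputable def Daz (α z : ℝ) (ρ σ : Matrix ι ι ℂ) : EReal :=
  if (suppLE ρ σ ∨ α < 1) ∧ Qaz α z ρ σ ≠ 0 then
    (((α - 1)⁻¹ * (Real.log (Qaz α z ρ σ) - Real.log (reTrace ρ)) : ℝ) : EReal)
  else ⊤

/-- The (normalized) Umegaki relative entropy. -/
noncomputable def DUm (ρ σ : Matrix ι ι ℂ) : EReal :=
  if suppLE ρ σ then
    (((reTrace ρ)⁻¹ * reTrace (ρ * (matLog ρ - matLog σ)) : ℝ) : EReal)
  else ⊤

/-- The Rényi `(α,z)`-divergence, with `D_{1,z} := D^Um`. -/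
noncomputable def Dfull (α z : ℝ) (ρ σ : Matrix ι ι ℂ) : EReal :=
  if α = 1 then DUm ρ σ else Daz α z ρ σ

/-- The max-relative entropy `D_max(ρ‖σ) = log inf {λ > 0 : ρ ≤ λ σ}`. -/
noncomputable def Dmax (ρ σ : Matrix ι ι ℂ) : EReal :=
  if ∃ c : ℝ, 0 < c ∧ loewnerLE ρ (c • σ) then
    ((Real.log (sInf {c : ℝ | 0 < c ∧ loewnerLE ρ (c • σ)}) : ℝ) : EReal)
  else ⊤

/-- The classical quantity `Q_α^cl(ρ‖σ) = ∑_x ρ(x)^α σ(x)^{1-α}` (with `0^t = 0` for `t ≠ 0`). -/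
noncomputable def Qcl {X : Type*} [Fintype X] (α : ℝ) (ρ σ : X → ℝ) : ℝ :=
  ∑ x, ρ x ^ α * σ x ^ (1 - α)

/-- Absolute continuity `ρ ≪ σ` for functions on a finite set. -/
def acl {X : Type*} (ρ σ : X → ℝ) : Prop := ∀ x, σ x = 0 → ρ x = 0

/-- The classical Rényi `α`-divergence, with values in `EReal`; for `α = 1` it is the
(normalized) Kullback-Leibler divergence. -/
noncomputable def Dcl {X : Type*} [Fintype X] (α : ℝ) (ρ σ : X → ℝ) : EReal :=
  if α = 1 then
    (if acl ρ σ then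
      ((((∑ x, ρ x)⁻¹ * ∑ x, ρ x * (Real.log (ρ x) - Real.log (σ x))) : ℝ) : EReal)
     else ⊤)
  else if (acl ρ σ ∨ α < 1) ∧ Qcl α ρ σ ≠ 0 then
    ((((α - 1)⁻¹ * (Real.log (Qcl α ρ σ) - Real.log (∑ x, ρ x))) : ℝ) : EReal)
  else ⊤

/-- The measured Rényi `α`-divergence: supremum over all finite-outcome POVMs. -/
noncomputable def Dmeas (α : ℝ) (ρ σ : Matrix ι ι ℂ) : EReal :=
  ⨆ (k : ℕ) (M : Fin k → Matrix ι ι ℂ)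
    (_ : (∀ i, (M i).PosSemidef) ∧ ∑ i, M i = 1),
    Dcl α (fun i => reTrace (M i * ρ)) (fun i => reTrace (M i * σ))

/-- A `κ`-function: a continuous nonnegative function on `[0,∞)` with
`limsup_{x→0⁺} f(x) x^{-κ} < ∞`. -/
def IsKappaFunction (κ : ℝ) (f : ℝ → ℝ) : Prop :=
  ContinuousOn f (Set.Ici 0) ∧ (∀ x ∈ Set.Ici (0 : ℝ), 0 ≤ f x) ∧
    ∃ M : ℝ, ∀ᶠ x in 𝓝[>] (0 : ℝ), f x ≤ M * x ^ κ

/-- A strict `κ`-function: a `κ`-function with `liminf_{x→0⁺} f(x) x^{-κ} > 0`. -/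
def IsStrictKappaFunction (κ : ℝ) (f : ℝ → ℝ) : Prop :=
  IsKappaFunction κ f ∧ ∃ c : ℝ, 0 < c ∧ ∀ᶠ x in 𝓝[>] (0 : ℝ), c * x ^ κ ≤ f x

/-- Nonzero PSD matrix predicate. -/
def PSDne (A : Matrix ι ι ℂ) : Prop := A.PosSemidef ∧ A ≠ 0


section Auxiliary

open scoped Matrix.Norms.L2Operator MatrixOrder

lemma continuousOn_spectrum_matrix (f : ℝ → ℝ) (A : Matrix ι ι ℂ) :
    ContinuousOn f (spectrum ℝ A) :=
  A.finite_real_spectrum.continuousOn f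

lemma hermApply_eq_cfc {A : Matrix ι ι ℂ} (hA : A.PosSemidef) (f : ℝ → ℝ) :
    hermApply f A = cfc f A := by
  rw [hermApply, dif_pos hA.1, hA.1.cfc_eq]

lemma nonneg_of_mem_spectrum {A : Matrix ι ι ℂ} (hA : A.PosSemidef) {t : ℝ}
    (ht : t ∈ spectrum ℝ A) : 0 ≤ t :=
  spectrum_nonneg_of_nonneg hA.nonneg ht

lemma abs_le_norm_of_mem_spectrum {A : Matrix ι ι ℂ} {t : ℝ} (ht : t ∈ spectrum ℝ A) :
    |t| ≤ ‖A‖ := by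
  rcases subsingleton_or_nontrivial (Matrix ι ι ℂ) with h | h
  · simp [spectrum.of_subsingleton] at ht
  · exact spectrum.norm_le_norm_of_mem ht

lemma le_norm_of_mem_spectrum {A : Matrix ι ι ℂ} {t : ℝ} (ht : t ∈ spectrum ℝ A) : t ≤ ‖A‖ :=
  (le_abs_self t).trans (abs_le_norm_of_mem_spectrum ht)

lemma matPow_eq_cfc {A : Matrix ι ι ℂ} (hA : A.PosSemidef) {x : ℝ} (hx : 0 < x) :
    matPow A x = cfc (fun t : ℝ => max t 0 ^ x) A := by
  rw [matPow, hermApply_eq_cfc hA]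
  refine cfc_congr fun t ht => ?_
  have h0 := nonneg_of_mem_spectrum hA ht
  simp only [max_eq_left h0]
  split_ifs with h
  · rw [h, Real.zero_rpow hx.ne']
  · rfl

lemma matPow_mul_matPow {A : Matrix ι ι ℂ} (hA : A.PosSemidef) (x y : ℝ) :
    matPow A x * matPow A y = matPow A (x + y) := by
  simp only [matPow, hermApply_eq_cfc hA]
  rw [← cfc_mul _ _ A (continuousOn_spectrum_matrix _ _) (continuousOn_spectrum_matrix _ _)]
  refine cfc_congr fun t ht => ?_
  have h0 := nonneg_of_mem_spectrum hA ht
  split_ifs with h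
  · simp
  · rw [Real.rpow_add (lt_of_le_of_ne h0 (Ne.symm h))]

lemma isSelfAdjoint_matPow {A : Matrix ι ι ℂ} (hA : A.PosSemidef) (x : ℝ) :
    IsSelfAdjoint (matPow A x) := by
  rw [matPow, hermApply_eq_cfc hA]
  exact cfc_predicate _ _

/-- Powers of a nonzero positive semidefinite matrix are nonzero. -/
lemma eq_zero_of_matPow_eq_zero {A : Matrix ι ι ℂ} (hA : A.PosSemidef) {x : ℝ}
    (h : matPow A x = 0) : A = 0 := by
  rw [matPow, hermApply_eq_cfc hA, ← cfc_const_zero ℝ A] at h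
  have hs := eqOn_of_cfc_eq_cfc h (continuousOn_spectrum_matrix _ _)
    (continuousOn_spectrum_matrix _ _) hA.1
  rw [← cfc_id ℝ A hA.1, ← cfc_const_zero ℝ A]
  refine cfc_congr fun t ht => ?_
  have h0 := nonneg_of_mem_spectrum hA ht
  have h1 := hs ht
  dsimp only at h1
  by_contra hne
  have hne' : t ≠ 0 := hne
  rw [if_neg hne'] at h1
  exact (Real.rpow_pos_of_pos (lt_of_le_of_ne h0 (Ne.symm hne')) x).ne' h1

lemma posSemidef_matPow {A : Matrix ι ι ℂ} (hA : A.PosSemidef) (x : ℝ) :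
    (matPow A x).PosSemidef := by
  rw [matPow, hermApply_eq_cfc hA, ← Matrix.nonneg_iff_posSemidef]
  refine cfc_nonneg fun t ht => ?_
  have h0 := nonneg_of_mem_spectrum hA ht
  split_ifs
  · exact le_rfl
  · exact Real.rpow_nonneg h0 x

omit [DecidableEq ι] in
lemma reTrace_ne_zero {A : Matrix ι ι ℂ} (hA : A.PosSemidef) (h : A ≠ 0) : reTrace A ≠ 0 := by
  intro h0
  refine h (hA.trace_eq_zero_iff.1 ?_)
  exact Complex.ext h0 (Complex.nonneg_iff.1 hA.trace_nonneg).2.symm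

/-- Joint continuity of the functional calculus in a parameter of the function and the matrix. -/
lemma continuousOn_cfc_param {h : ℝ → ℝ → ℝ}
    (hh : ContinuousOn (Function.uncurry h) (Ioi 0 ×ˢ univ)) :
    ContinuousOn (fun q : ℝ × Matrix ι ι ℂ => cfc (h q.1) q.2)
      (Ioi 0 ×ˢ {A | IsSelfAdjoint A}) := by
  rintro ⟨p₀, A₀⟩ ⟨hp₀, hA₀⟩
  have hp₀' : (0 : ℝ) < p₀ := hp₀
  set K : Set ℝ := Metric.closedBall 0 (‖A₀‖ + 1)
  have hK : IsCompact K := isCompact_closedBall _ _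
  have hspec : ∀ A : Matrix ι ι ℂ, ‖A‖ ≤ ‖A₀‖ + 1 → spectrum ℝ A ⊆ K := by
    intro A hA t ht
    rw [mem_closedBall_zero_iff]
    exact (abs_le_norm_of_mem_spectrum ht).trans hA
  have hcont : ∀ p : ℝ, 0 < p → ContinuousOn (h p) K := fun p hp =>
    hh.comp (f := fun t : ℝ => (p, t)) (by fun_prop) fun t _ => ⟨hp, mem_univ _⟩
  have hunif : TendstoUniformlyOn h (h p₀) (𝓝[Ioi 0] p₀) K := by
    rw [Metric.tendstoUniformlyOn_iff]
    intro ε hε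
    have hmem := hK.mem_uniformity_of_prod (f := h) (k := K) (s := Ioi 0) (q := p₀)
      (u := {q | dist q.1 q.2 < ε})
      (hh.mono (prod_mono_right (subset_univ _))) hp₀ (Metric.dist_mem_uniformity hε)
    obtain ⟨v, hv, hv'⟩ := hmem
    filter_upwards [hv] with p hp t ht
    rw [dist_comm]
    exact hv' p hp t ht
  have key := (continuousOn_cfc_setProd (A := Matrix ι ι ℂ) (𝕜 := ℝ) (p := IsSelfAdjoint) hK)
    (UniformOnFun.ofFun {K} (h p₀), A₀) ⟨hcont p₀ hp₀', hA₀, hspec A₀ (by linarith)⟩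
  have hmap : Tendsto (fun q : ℝ × Matrix ι ι ℂ => (UniformOnFun.ofFun {K} (h q.1), q.2))
      (𝓝[Ioi 0 ×ˢ {A | IsSelfAdjoint A}] (p₀, A₀))
      (𝓝[{f | ContinuousOn (UniformOnFun.toFun {K} f) K} ×ˢ
        {a : Matrix ι ι ℂ | IsSelfAdjoint a ∧ spectrum ℝ a ⊆ K}]
        (UniformOnFun.ofFun {K} (h p₀), A₀)) := by
    rw [tendsto_nhdsWithin_iff]
    constructor
    · rw [nhds_prod_eq, nhdsWithin_prod_eq]
      refine Tendsto.prodMap (f := fun p => UniformOnFun.ofFun {K} (h p))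
        (g := fun A : Matrix ι ι ℂ => A) ?_ (tendsto_id.mono_left nhdsWithin_le_nhds)
      rw [UniformOnFun.tendsto_iff_tendstoUniformlyOn]
      simpa using! hunif
    · have hn : ∀ᶠ q : ℝ × Matrix ι ι ℂ in 𝓝[Ioi 0 ×ˢ {A | IsSelfAdjoint A}] (p₀, A₀),
          ‖q.2‖ < ‖A₀‖ + 1 := by
        refine nhdsWithin_le_nhds ?_
        exact (continuous_snd.norm.tendsto (p₀, A₀)).eventually_lt_const (by simp)
      filter_upwards [hn, self_mem_nhdsWithin] with q hq hq'
      exact ⟨hcont q.1 hq'.1, hq'.2, hspec q.2 hq.le⟩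
  exact key.tendsto.comp hmap

lemma continuousOn_uncurry_max_rpow :
    ContinuousOn (Function.uncurry fun x t : ℝ => max t 0 ^ x) (Ioi 0 ×ˢ univ) := by
  rintro ⟨x, t⟩ ⟨hx, -⟩
  refine ContinuousAt.continuousWithinAt ?_
  exact ContinuousAt.rpow (f := fun q : ℝ × ℝ => max q.2 0) (g := fun q => q.1)
    (by fun_prop) (by fun_prop) (Or.inr hx)

lemma continuousOn_uncurry_truncated_rpow {ε : ℝ} (hε : 0 < ε) :
    ContinuousOn (Function.uncurry fun s t : ℝ => max t ε ^ (-s)) (Ioi 0 ×ˢ univ) := by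
  rintro ⟨s, t⟩ -
  refine ContinuousAt.continuousWithinAt ?_
  exact ContinuousAt.rpow (f := fun q : ℝ × ℝ => max q.2 ε) (g := fun q => -q.1)
    (by fun_prop) (by fun_prop) (Or.inl (lt_max_of_lt_right hε).ne')

lemma exists_bound_of_isKappaFunction {κ : ℝ} {f : ℝ → ℝ} (hκ : 0 < κ)
    (hf : IsKappaFunction κ f) {R : ℝ} :
    ∃ M : ℝ, 0 < M ∧ ∀ x ∈ Icc 0 R, f x ≤ M * x ^ κ := by
  obtain ⟨hc, -, M, hM⟩ := hf
  obtain ⟨r, hr, hrM⟩ := mem_nhdsGT_iff_exists_Ioo_subset.1 hM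
  have hr : 0 < r := hr
  obtain ⟨B, hB⟩ := (isCompact_Icc (a := 0) (b := R)).exists_bound_of_continuousOn
    (hc.mono Icc_subset_Ici_self)
  have h0 : f 0 ≤ 0 := by
    have h1 : Tendsto f (𝓝[>] 0) (𝓝 (f 0)) :=
      (hc 0 self_mem_Ici).mono_left (nhdsWithin_mono _ Ioi_subset_Ici_self)
    have h2 : Tendsto (fun x : ℝ => M * x ^ κ) (𝓝[>] 0) (𝓝 (M * 0 ^ κ)) :=
      ((Real.continuousAt_rpow_const 0 κ (Or.inr hκ.le)).tendsto.mono_left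
        nhdsWithin_le_nhds).const_mul M
    rw [Real.zero_rpow hκ.ne', mul_zero] at h2
    exact le_of_tendsto_of_tendsto h1 h2 hM
  have hrκ : 0 < r ^ κ := Real.rpow_pos_of_pos hr κ
  refine ⟨|M| + |B| / r ^ κ + 1, by positivity, fun x hx => ?_⟩
  rcases hx.1.eq_or_lt with rfl | hx0
  · rwa [Real.zero_rpow hκ.ne', mul_zero]
  have hxκ : 0 ≤ x ^ κ := Real.rpow_nonneg hx.1 κ
  have hBr : 0 ≤ |B| / r ^ κ := by positivity
  rcases lt_or_ge x r with hxr | hxr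
  · have h1 : f x ≤ M * x ^ κ := hrM ⟨hx0, hxr⟩
    refine h1.trans (mul_le_mul_of_nonneg_right ?_ hxκ)
    linarith [le_abs_self M]
  · calc f x ≤ |B| := (le_abs_self _).trans ((hB x hx).trans (le_abs_self B))
      _ = |B| / r ^ κ * r ^ κ := by field_simp
      _ ≤ |B| / r ^ κ * x ^ κ :=
        mul_le_mul_of_nonneg_left (Real.rpow_le_rpow hr.le hxr hκ.le) hBr
      _ ≤ _ := mul_le_mul_of_nonneg_right (by linarith [abs_nonneg M]) hxκ

/-- If `ρ ≤ M σ ^ κ`, then `ρ ^ a` is dominated by `σ ^ b` for `b ≤ κ * min 1 a`. -/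
lemma cfc_rpow_le_of_le {ρ σ : Matrix ι ι ℂ} (hρ : ρ.PosSemidef) (hσ : σ.PosSemidef)
    {κ M R a b : ℝ} (hM : 0 < M) (ha : 0 < a) (hb : 0 < b)
    (hbκ : b ≤ κ * min 1 a) (hρR : ‖ρ‖ ≤ R) (hσR : ‖σ‖ ≤ R)
    (h : ρ ≤ cfc (fun t : ℝ => M * t ^ κ) σ) :
    cfc (fun t : ℝ => t ^ a) ρ ≤
      cfc (fun t : ℝ => R ^ (a - min 1 a) * (M ^ min 1 a * R ^ (κ * min 1 a - b)) * t ^ b) σ := by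
  have hR : 0 ≤ R := (norm_nonneg _).trans hρR
  set e := min 1 a with he
  have he0 : 0 < e := lt_min one_pos ha
  have hea : e ≤ a := min_le_right _ _
  have hcfc : (0 : Matrix ι ι ℂ) ≤ cfc (fun t : ℝ => M * t ^ κ) σ :=
    hρ.nonneg.trans h
  have h1 : ρ ^ e ≤ (cfc (fun t : ℝ => M * t ^ κ) σ) ^ e :=
    CFC.rpow_le_rpow ⟨he0.le, min_le_left _ _⟩ h
  have hcomp := cfc_comp' (fun t : ℝ => t ^ e) (fun t : ℝ => M * t ^ κ) σ
    ((σ.finite_real_spectrum.image _).continuousOn _) (continuousOn_spectrum_matrix _ _) hσ.1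
  rw [CFC.rpow_eq_cfc_real hρ.nonneg, CFC.rpow_eq_cfc_real hcfc, ← hcomp] at h1
  have hsplit : ∀ {t p q : ℝ}, 0 ≤ t → t ≤ R → 0 < q → q ≤ p → t ^ p ≤ R ^ (p - q) * t ^ q := by
    intro t p q ht htR hq hqp
    have : t ^ p = t ^ (p - q) * t ^ q := by
      rw [← Real.rpow_add_of_nonneg ht (by linarith) hq.le, sub_add_cancel]
    rw [this]
    exact mul_le_mul_of_nonneg_right (Real.rpow_le_rpow ht htR (by linarith))
      (Real.rpow_nonneg ht _)
  have hRa : 0 ≤ R ^ (a - e) := Real.rpow_nonneg hR _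
  calc cfc (fun t : ℝ => t ^ a) ρ
      ≤ cfc (fun t : ℝ => R ^ (a - e) * t ^ e) ρ := by
        refine cfc_mono (fun t ht => ?_) (continuousOn_spectrum_matrix _ _)
          (continuousOn_spectrum_matrix _ _)
        exact hsplit (nonneg_of_mem_spectrum hρ ht) ((le_norm_of_mem_spectrum ht).trans hρR)
          he0 hea
    _ = R ^ (a - e) • cfc (fun t : ℝ => t ^ e) ρ :=
        cfc_const_mul _ _ _ (continuousOn_spectrum_matrix _ _)
    _ ≤ R ^ (a - e) • cfc (fun t : ℝ => (M * t ^ κ) ^ e) σ :=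
        smul_le_smul_of_nonneg_left h1 hRa
    _ = cfc (fun t : ℝ => R ^ (a - e) * (M * t ^ κ) ^ e) σ :=
        (cfc_const_mul _ _ _ (continuousOn_spectrum_matrix _ _)).symm
    _ ≤ _ := by
        refine cfc_mono (fun t ht => ?_) (continuousOn_spectrum_matrix _ _)
          (continuousOn_spectrum_matrix _ _)
        have ht0 := nonneg_of_mem_spectrum hσ ht
        rw [mul_assoc, mul_assoc, Real.mul_rpow hM.le (Real.rpow_nonneg ht0 _),
          ← Real.rpow_mul ht0]
        refine mul_le_mul_of_nonneg_left (mul_le_mul_of_nonneg_left ?_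
          (Real.rpow_nonneg hM.le _)) hRa
        exact hsplit ht0 ((le_norm_of_mem_spectrum ht).trans hσR) hb hbκ

/-- If `Y * Y` is dominated by `g(σ)`, then `Y * k(σ)` is controlled by `k ^ 2 * g`. -/
lemma norm_mul_cfc_sq_le {Y σ : Matrix ι ι ℂ} (hσ : σ.PosSemidef) (hY : IsSelfAdjoint Y)
    {g k : ℝ → ℝ} {B : ℝ} (hB : 0 ≤ B) (hYY : Y * Y ≤ cfc g σ)
    (hk : ∀ t, 0 ≤ t → 0 ≤ k t * g t * k t ∧ k t * g t * k t ≤ B) :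
    ‖Y * cfc k σ‖ ^ 2 ≤ B := by
  have hks : IsSelfAdjoint (cfc k σ) := cfc_predicate _ _
  have h1 : star (Y * cfc k σ) * (Y * cfc k σ) = cfc k σ * (Y * Y) * cfc k σ := by
    rw [star_mul, hY.star_eq, hks.star_eq]
    simp only [mul_assoc]
  have h2 : cfc k σ * cfc g σ * cfc k σ = cfc (fun t => k t * g t * k t) σ := by
    rw [← cfc_mul _ _ σ (continuousOn_spectrum_matrix _ _) (continuousOn_spectrum_matrix _ _),
      ← cfc_mul _ _ σ (continuousOn_spectrum_matrix _ _) (continuousOn_spectrum_matrix _ _)]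
  rw [sq, ← CStarRing.norm_star_mul_self]
  calc ‖star (Y * cfc k σ) * (Y * cfc k σ)‖
      ≤ ‖cfc (fun t => k t * g t * k t) σ‖ := by
        refine CStarAlgebra.norm_le_norm_of_nonneg_of_le (star_mul_self_nonneg _) ?_
        rw [h1, ← h2]
        exact hks.conjugate_le_conjugate hYY
    _ ≤ B := by
        refine norm_cfc_le hB fun t ht => ?_
        have h := hk t (nonneg_of_mem_spectrum hσ ht)
        rw [Real.norm_of_nonneg h.1]
        exact h.2

lemma suppLE_of_le_hermApply {ρ σ : Matrix ι ι ℂ} (hρ : ρ.PosSemidef) (hσ : σ.PosSemidef)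
    {f : ℝ → ℝ} (hf : f 0 = 0) (h : loewnerLE ρ (hermApply f σ)) : suppLE ρ σ := by
  intro v hv
  have hfac : hermApply f σ = cfc (fun t => f t / t) σ * σ := by
    have hid : cfc id σ = σ := cfc_id ℝ σ hσ.1.isSelfAdjoint
    nth_rewrite 3 [← hid]
    rw [hermApply_eq_cfc hσ, ← cfc_mul _ _ σ (continuousOn_spectrum_matrix _ _)
      (continuousOn_spectrum_matrix _ _)]
    refine cfc_congr fun t _ => ?_
    rcases eq_or_ne t 0 with rfl | ht
    · simp [hf]
    · simp [ht]
  have hfv : (hermApply f σ).mulVec v = 0 := by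
    rw [hfac, ← Matrix.mulVec_mulVec, hv, Matrix.mulVec_zero]
  have h1 := h.dotProduct_mulVec_nonneg v
  have h2 := hρ.dotProduct_mulVec_nonneg v
  rw [Matrix.sub_mulVec, hfv, zero_sub, dotProduct_neg] at h1
  exact (hρ.dotProduct_mulVec_zero_iff v).1 (le_antisymm (neg_nonneg.1 h1) h2)

lemma le_cfc_rpow_of_le_hermApply {ρ σ : Matrix ι ι ℂ} (hσ : σ.PosSemidef) {f : ℝ → ℝ}
    {κ M R : ℝ} (hM : ∀ x ∈ Icc 0 R, f x ≤ M * x ^ κ) (hσR : ‖σ‖ ≤ R)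
    (h : loewnerLE ρ (hermApply f σ)) : ρ ≤ cfc (fun t : ℝ => M * t ^ κ) σ := by
  have h1 : ρ ≤ hermApply f σ := h
  rw [hermApply_eq_cfc hσ] at h1
  exact h1.trans (cfc_mono (fun t ht => hM t ⟨nonneg_of_mem_spectrum hσ ht,
    (le_norm_of_mem_spectrum ht).trans hσR⟩) (continuousOn_spectrum_matrix _ _)
    (continuousOn_spectrum_matrix _ _))

/-- The square of `ρ ^ (a / 2)` is dominated by a power of `σ`. -/
lemma matPow_half_mul_self_le {ρ σ : Matrix ι ι ℂ} (hρ : ρ.PosSemidef) (hσ : σ.PosSemidef)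
    {κ M R a b : ℝ} (hM : 0 < M) (ha : 0 < a) (hb : 0 < b)
    (hbκ : b ≤ κ * min 1 a) (hρR : ‖ρ‖ ≤ R) (hσR : ‖σ‖ ≤ R)
    (h : ρ ≤ cfc (fun t : ℝ => M * t ^ κ) σ) :
    matPow ρ (a / 2) * matPow ρ (a / 2) ≤
      cfc (fun t : ℝ => R ^ (a - min 1 a) * (M ^ min 1 a * R ^ (κ * min 1 a - b)) * t ^ b) σ := by
  rw [matPow_mul_matPow hρ, add_halves, matPow_eq_cfc hρ ha]
  refine le_trans (le_of_eq (cfc_congr fun t ht => ?_))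
    (cfc_rpow_le_of_le hρ hσ hM ha hb hbκ hρR hσR h)
  simp [max_eq_left (nonneg_of_mem_spectrum hρ ht)]

lemma rpow_neg_sub_truncated_bound {s δ C ε t : ℝ} (hs : 0 < s) (hδ : 0 < δ) (hC : 0 ≤ C)
    (hε : 0 < ε) (ht : 0 ≤ t) :
    let k : ℝ → ℝ := fun t => (if t = 0 then 0 else t ^ (-s)) - max t ε ^ (-s)
    0 ≤ k t * (C * t ^ (2 * s + δ)) * k t ∧ k t * (C * t ^ (2 * s + δ)) * k t ≤ C * ε ^ δ := by
  intro k
  have hεδ : 0 ≤ ε ^ δ := Real.rpow_nonneg hε.le _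
  have htb : 0 ≤ t ^ (2 * s + δ) := Real.rpow_nonneg ht _
  refine ⟨?_, ?_⟩
  · have : k t * (C * t ^ (2 * s + δ)) * k t = C * t ^ (2 * s + δ) * (k t) ^ 2 := by ring
    rw [this]
    positivity
  rcases ht.eq_or_lt with rfl | ht0
  · rw [Real.zero_rpow (by positivity)]
    simpa using mul_nonneg hC hεδ
  rcases le_total ε t with h | h
  · have : k t = 0 := by simp [k, ht0.ne', max_eq_left h]
    rw [this]
    simpa using mul_nonneg hC hεδ
  · have hk : k t = t ^ (-s) - ε ^ (-s) := by simp [k, ht0.ne', max_eq_right h]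
    have h1 : ε ^ (-s) ≤ t ^ (-s) := Real.rpow_le_rpow_of_nonpos ht0 h (by linarith)
    have h2 : 0 ≤ ε ^ (-s) := Real.rpow_nonneg hε.le _
    have hk2 : k t * k t ≤ t ^ (-s) * t ^ (-s) := by
      rw [hk]
      exact mul_le_mul (by linarith) (by linarith) (by linarith) (by linarith)
    calc k t * (C * t ^ (2 * s + δ)) * k t = C * (k t * k t * t ^ (2 * s + δ)) := by ring
      _ ≤ C * (t ^ (-s) * t ^ (-s) * t ^ (2 * s + δ)) := by gcongr
      _ = C * t ^ δ := by
        rw [← Real.rpow_add ht0, ← Real.rpow_add ht0]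
        ring_nf
      _ ≤ C * ε ^ δ := by gcongr

/-- The set of `(α, z, ρ, σ)` on which continuity is considered. -/
def kappaDomain (ι : Type*) [Fintype ι] [DecidableEq ι] (κ : ℝ) (f : ℝ → ℝ) :
    Set (ℝ × ℝ × Matrix ι ι ℂ × Matrix ι ι ℂ) :=
  {x | 1 < x.1 ∧ 0 < x.2.1 ∧ (1 - κ) * x.1 < 1 ∧ (x.1 - 1) / κ < x.2.1 ∧
    PSDne x.2.2.1 ∧ PSDne x.2.2.2 ∧ loewnerLE x.2.2.1 (hermApply f x.2.2.2)}

/-- The operator `ρ ^ (α / (2 z)) * σ ^ ((1 - α) / (2 z))`. -/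
def renyiFactor (x : ℝ × ℝ × Matrix ι ι ℂ × Matrix ι ι ℂ) : Matrix ι ι ℂ :=
  matPow x.2.2.1 (x.1 / x.2.1 / 2) * matPow x.2.2.2 (-((x.1 - 1) / (2 * x.2.1)))

lemma lt_mul_min_of_mem_kappaDomain {κ : ℝ} (hκ : 0 < κ) {α z : ℝ} (hz : 0 < z)
    (h1 : (1 - κ) * α < 1) (h2 : (α - 1) / κ < z) : (α - 1) / z < κ * min 1 (α / z) := by
  rcases min_choice 1 (α / z) with h | h <;> rw [h]
  · rw [div_lt_iff₀ hκ] at h2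
    rw [div_lt_iff₀ hz]
    linarith
  · rw [← mul_div_assoc]
    gcongr
    linarith

lemma continuousOn_cfc_comp {X : Type*} [TopologicalSpace X] {S : Set X} {h : ℝ → ℝ → ℝ}
    (hh : ContinuousOn (Function.uncurry h) (Ioi 0 ×ˢ univ)) {p : X → ℝ}
    {A : X → Matrix ι ι ℂ} (hp : ContinuousOn p S) (hA : ContinuousOn A S)
    (hp0 : ∀ x ∈ S, 0 < p x) (hAs : ∀ x ∈ S, IsSelfAdjoint (A x)) :
    ContinuousOn (fun x => cfc (h (p x)) (A x)) S :=
  (continuousOn_cfc_param hh).comp (hp.prodMk hA) fun x hx => ⟨hp0 x hx, hAs x hx⟩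

lemma continuousOn_matPow {X : Type*} [TopologicalSpace X] {S : Set X} {p : X → ℝ}
    {A : X → Matrix ι ι ℂ} (hp : ContinuousOn p S) (hA : ContinuousOn A S)
    (hp0 : ∀ x ∈ S, 0 < p x) (hAs : ∀ x ∈ S, (A x).PosSemidef) :
    ContinuousOn (fun x => matPow (A x) (p x)) S :=
  (continuousOn_cfc_comp continuousOn_uncurry_max_rpow hp hA hp0
    fun x hx => (hAs x hx).1).congr fun x hx => matPow_eq_cfc (hAs x hx) (hp0 x hx)

lemma continuousOn_renyiFactor {κ : ℝ} (hκ : 0 < κ) {f : ℝ → ℝ} (hf : IsKappaFunction κ f) :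
    ContinuousOn (renyiFactor (ι := ι)) (kappaDomain ι κ f) := by
  intro x₀ hx₀
  have hα₀ : 1 < x₀.1 := hx₀.1
  have hz₀ : 0 < x₀.2.1 := hx₀.2.1
  set R : ℝ := ‖x₀.2.2.1‖ + ‖x₀.2.2.2‖ + 1 with hR
  have hR0 : 0 < R := by positivity
  obtain ⟨M, hM, hfM⟩ := exists_bound_of_isKappaFunction (R := R) hκ hf
  have hgap := lt_mul_min_of_mem_kappaDomain hκ hz₀ hx₀.2.2.1 hx₀.2.2.2.1
  set δ : ℝ := (κ * min 1 (x₀.1 / x₀.2.1) - (x₀.1 - 1) / x₀.2.1) / 2 with hδ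
  have hδ0 : 0 < δ := by rw [hδ]; linarith
  let e : ℝ × ℝ × Matrix ι ι ℂ × Matrix ι ι ℂ → ℝ := fun x => min 1 (x.1 / x.2.1)
  let b : ℝ × ℝ × Matrix ι ι ℂ × Matrix ι ι ℂ → ℝ := fun x => 2 * ((x.1 - 1) / (2 * x.2.1)) + δ
  let C : ℝ × ℝ × Matrix ι ι ℂ × Matrix ι ι ℂ → ℝ := fun x =>
    R ^ (x.1 / x.2.1 - e x) * (M ^ e x * R ^ (κ * e x - b x))
  have ha : ContinuousAt (fun x : ℝ × ℝ × Matrix ι ι ℂ × Matrix ι ι ℂ => x.1 / x.2.1) x₀ := by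
    fun_prop (disch := exact hz₀.ne')
  have he : ContinuousAt e x₀ := Tendsto.min tendsto_const_nhds ha
  have hb : ContinuousAt b x₀ := by
    have : 2 * x₀.2.1 ≠ 0 := by positivity
    fun_prop (disch := assumption)
  have hC : ContinuousAt C x₀ :=
    (continuousAt_const.rpow (ha.sub he) (Or.inl hR0.ne')).mul
      ((continuousAt_const.rpow he (Or.inl hM.ne')).mul
        (continuousAt_const.rpow ((he.const_mul κ).sub hb) (Or.inl hR0.ne')))
  have hbe : ∀ᶠ x in 𝓝 x₀, b x < κ * e x := by
    refine hb.eventually_lt (he.const_mul κ) ?_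
    have : b x₀ = (x₀.1 - 1) / x₀.2.1 + δ := by
      simp only [b]
      field_simp
    rw [this, hδ]
    simp only [e]
    linarith
  have hCC : ∀ᶠ x in 𝓝 x₀, C x < C x₀ + 1 := hC.eventually_lt_const (by linarith)
  have hρR : ∀ᶠ x : ℝ × ℝ × Matrix ι ι ℂ × Matrix ι ι ℂ in 𝓝 x₀, ‖x.2.2.1‖ < R := by
    refine ((by fun_prop : Continuous fun x : ℝ × ℝ × Matrix ι ι ℂ × Matrix ι ι ℂ =>
      ‖x.2.2.1‖).tendsto x₀).eventually_lt_const ?_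
    linarith [norm_nonneg x₀.2.2.2]
  have hσR : ∀ᶠ x : ℝ × ℝ × Matrix ι ι ℂ × Matrix ι ι ℂ in 𝓝 x₀, ‖x.2.2.2‖ < R := by
    refine ((by fun_prop : Continuous fun x : ℝ × ℝ × Matrix ι ι ℂ × Matrix ι ι ℂ =>
      ‖x.2.2.2‖).tendsto x₀).eventually_lt_const ?_
    linarith [norm_nonneg x₀.2.2.1]
  have hC0 : 0 < C x₀ + 1 := by positivity
  refine continuousWithinAt_of_locally_uniform_approx_of_continuousWithinAt hx₀ fun u hu => ?_
  obtain ⟨η, hη, hηu⟩ := Metric.mem_uniformity_dist.1 hu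
  obtain ⟨ε, hε, hεη⟩ : ∃ ε : ℝ, 0 < ε ∧ (C x₀ + 1) * ε ^ δ < η ^ 2 := by
    have h1 : Tendsto (fun ε : ℝ => (C x₀ + 1) * ε ^ δ) (𝓝[>] 0) (𝓝 ((C x₀ + 1) * 0 ^ δ)) :=
      ((Real.continuousAt_rpow_const 0 δ (Or.inr hδ0.le)).tendsto.mono_left
        nhdsWithin_le_nhds).const_mul _
    rw [Real.zero_rpow hδ0.ne', mul_zero] at h1
    obtain ⟨ε, h2, h3⟩ := ((h1.eventually_lt_const (by positivity : (0 : ℝ) < η ^ 2)).and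
      self_mem_nhdsWithin).exists
    exact ⟨ε, h3, h2⟩
  refine ⟨_, inter_mem self_mem_nhdsWithin
    (nhdsWithin_le_nhds (hbe.and (hCC.and (hρR.and hσR)))),
    fun x => matPow x.2.2.1 (x.1 / x.2.1 / 2) *
      cfc (fun t : ℝ => max t ε ^ (-((x.1 - 1) / (2 * x.2.1)))) x.2.2.2, ?_, ?_⟩
  · have hdiv : ContinuousOn (fun x : ℝ × ℝ × Matrix ι ι ℂ × Matrix ι ι ℂ => x.1 / x.2.1 / 2)
        (kappaDomain ι κ f) := by
      refine ContinuousOn.div_const ?_ _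
      exact continuousOn_fst.div (by fun_prop) fun x hx => hx.2.1.ne'
    have hs : ContinuousOn
        (fun x : ℝ × ℝ × Matrix ι ι ℂ × Matrix ι ι ℂ => (x.1 - 1) / (2 * x.2.1))
        (kappaDomain ι κ f) :=
      ContinuousOn.div (by fun_prop) (by fun_prop) fun x hx => (mul_pos two_pos hx.2.1).ne'
    refine ContinuousOn.mul (continuousOn_matPow hdiv (by fun_prop) ?_ ?_)
      (continuousOn_cfc_comp (continuousOn_uncurry_truncated_rpow hε) hs (by fun_prop) ?_ ?_) x₀ hx₀
    · exact fun x hx => by have := hx.1; have := hx.2.1; positivity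
    · exact fun x hx => hx.2.2.2.2.1.1
    · exact fun x hx => div_pos (sub_pos.2 hx.1) (mul_pos two_pos hx.2.1)
    · exact fun x hx => hx.2.2.2.2.2.1.1.1
  · rintro x ⟨hx, hxb, hxC, hxρ, hxσ⟩
    apply hηu
    have hα : 1 < x.1 := hx.1
    have hz : 0 < x.2.1 := hx.2.1
    have hρ : x.2.2.1.PosSemidef := hx.2.2.2.2.1.1
    have hσ : x.2.2.2.PosSemidef := hx.2.2.2.2.2.1.1
    have hs : 0 < (x.1 - 1) / (2 * x.2.1) := div_pos (sub_pos.2 hα) (by positivity)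
    have hb0 : 0 < b x := by simp only [b]; linarith
    have hdom := matPow_half_mul_self_le hρ hσ hM (div_pos (by linarith) hz) hb0 hxb.le
      hxρ.le hxσ.le (le_cfc_rpow_of_le_hermApply hσ hfM hxσ.le hx.2.2.2.2.2.2)
    have hCx : 0 ≤ C x := by positivity
    have hbound := norm_mul_cfc_sq_le hσ (isSelfAdjoint_matPow hρ _)
      (by positivity : 0 ≤ C x * ε ^ δ) hdom
      fun t ht => rpow_neg_sub_truncated_bound hs hδ0 hCx hε ht
    rw [renyiFactor, dist_eq_norm, ← mul_sub, matPow.eq_1 x.2.2.2, hermApply_eq_cfc hσ,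
      ← cfc_sub _ _ _ (continuousOn_spectrum_matrix _ _) (continuousOn_spectrum_matrix _ _)]
    refine lt_of_pow_lt_pow_left₀ 2 hη.le ((hbound.trans ?_).trans_lt hεη)
    gcongr

lemma renyiFactor_ne_zero {κ : ℝ} (hκ : 0 < κ) {f : ℝ → ℝ} (hf : IsKappaFunction κ f)
    {x : ℝ × ℝ × Matrix ι ι ℂ × Matrix ι ι ℂ} (hx : x ∈ kappaDomain ι κ f) :
    renyiFactor x ≠ 0 := by
  intro h0
  obtain ⟨hα, hz, h1, h2, ⟨hρ, hρ0⟩, ⟨hσ, -⟩, hle⟩ := hx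
  obtain ⟨M, hM, hfM⟩ := exists_bound_of_isKappaFunction (R := ‖x.2.2.1‖ + ‖x.2.2.2‖) hκ hf
  have hρR : ‖x.2.2.1‖ ≤ ‖x.2.2.1‖ + ‖x.2.2.2‖ := by linarith [norm_nonneg x.2.2.2]
  have hσR : ‖x.2.2.2‖ ≤ ‖x.2.2.1‖ + ‖x.2.2.2‖ := by linarith [norm_nonneg x.2.2.1]
  have hb0 : 0 < (x.1 - 1) / x.2.1 := div_pos (sub_pos.2 hα) hz
  have hdom := matPow_half_mul_self_le hρ hσ hM (div_pos (by linarith) hz) hb0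
    (lt_mul_min_of_mem_kappaDomain hκ hz h1 h2).le hρR hσR
    (le_cfc_rpow_of_le_hermApply hσ hfM hσR hle)
  have hker := norm_mul_cfc_sq_le (k := fun t => if t = 0 then 1 else 0) hσ
    (isSelfAdjoint_matPow hρ _) le_rfl hdom fun t _ => by
      split_ifs with h
      · simp [h, Real.zero_rpow hb0.ne']
      · simp
  have hker' : matPow x.2.2.1 (x.1 / x.2.1 / 2) *
      cfc (fun t : ℝ => if t = 0 then 1 else 0) x.2.2.2 = 0 :=
    norm_eq_zero.1 (pow_eq_zero_iff two_ne_zero |>.1 (le_antisymm hker (sq_nonneg _)))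
  have hone : cfc (fun t : ℝ => if t = 0 then 1 else 0) x.2.2.2 + matPow x.2.2.2 0 = 1 := by
    rw [matPow, hermApply_eq_cfc hσ, ← cfc_add (a := x.2.2.2) _ _ (continuousOn_spectrum_matrix _ _)
      (continuousOn_spectrum_matrix _ _), ← cfc_const_one ℝ x.2.2.2 hσ.1.isSelfAdjoint]
    refine cfc_congr fun t _ => ?_
    split_ifs <;> simp
  have hsupp : matPow x.2.2.1 (x.1 / x.2.1 / 2) * matPow x.2.2.2 0 = 0 := by
    have := congrArg (· * matPow x.2.2.2 ((x.1 - 1) / (2 * x.2.1))) h0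
    simpa [renyiFactor, mul_assoc, matPow_mul_matPow hσ] using this
  refine hρ0 (eq_zero_of_matPow_eq_zero hρ (x := x.1 / x.2.1 / 2) ?_)
  rw [← mul_one (matPow _ _), ← hone, mul_add, hker', hsupp, add_zero]

lemma Qaz_eq_renyiFactor {α z : ℝ} {ρ σ : Matrix ι ι ℂ} (hρ : ρ.PosSemidef)
    (hσ : σ.PosSemidef) :
    Qaz α z ρ σ = reTrace (matPow (star (renyiFactor (α, z, ρ, σ)) *
      renyiFactor (α, z, ρ, σ)) z) := by
  rw [Qaz, renyiFactor, star_mul, (isSelfAdjoint_matPow hρ _).star_eq,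
    (isSelfAdjoint_matPow hσ _).star_eq]
  dsimp only
  nth_rewrite 1 [← add_halves (α / z)]
  rw [← matPow_mul_matPow hρ, ← neg_div, neg_sub]
  simp only [mul_assoc]

omit [DecidableEq ι] in
lemma continuousOn_reTrace_comp {X : Type*} [TopologicalSpace X] {S : Set X}
    {A : X → Matrix ι ι ℂ} (hA : ContinuousOn A S) : ContinuousOn (fun x => reTrace (A x)) S :=
  Complex.continuous_re.comp_continuousOn
    ((continuous_id.matrix_trace (A := fun B : Matrix ι ι ℂ => B)).comp_continuousOn hA)

lemma posSemidef_star_renyiFactor_mul_self (x : ℝ × ℝ × Matrix ι ι ℂ × Matrix ι ι ℂ) :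
    (star (renyiFactor x) * renyiFactor x).PosSemidef :=
  Matrix.posSemidef_conjTranspose_mul_self _

lemma continuousOn_Qaz_kappaDomain {κ : ℝ} (hκ : 0 < κ) {f : ℝ → ℝ}
    (hf : IsKappaFunction κ f) :
    ContinuousOn
      (fun x : ℝ × ℝ × Matrix ι ι ℂ × Matrix ι ι ℂ => Qaz x.1 x.2.1 x.2.2.1 x.2.2.2)
      (kappaDomain ι κ f) := by
  have hF := continuousOn_renyiFactor (ι := ι) hκ hf
  have hFF : ContinuousOn (fun x => star (renyiFactor x) * renyiFactor x) (kappaDomain ι κ f) :=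
    hF.star.mul hF
  have hz : ContinuousOn (fun x : ℝ × ℝ × Matrix ι ι ℂ × Matrix ι ι ℂ => x.2.1)
      (kappaDomain ι κ f) := by fun_prop
  refine (continuousOn_reTrace_comp (continuousOn_matPow hz hFF (fun x hx => hx.2.1)
    fun x _ => posSemidef_star_renyiFactor_mul_self x)).congr fun x hx => ?_
  exact Qaz_eq_renyiFactor hx.2.2.2.2.1.1 hx.2.2.2.2.2.1.1

lemma Qaz_ne_zero_of_mem_kappaDomain {κ : ℝ} (hκ : 0 < κ) {f : ℝ → ℝ}
    (hf : IsKappaFunction κ f) {x : ℝ × ℝ × Matrix ι ι ℂ × Matrix ι ι ℂ}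
    (hx : x ∈ kappaDomain ι κ f) : Qaz x.1 x.2.1 x.2.2.1 x.2.2.2 ≠ 0 := by
  rw [Qaz_eq_renyiFactor hx.2.2.2.2.1.1 hx.2.2.2.2.2.1.1]
  have hpsd := posSemidef_star_renyiFactor_mul_self x
  refine reTrace_ne_zero (posSemidef_matPow hpsd _) fun h => ?_
  exact renyiFactor_ne_zero hκ hf hx
    (CStarRing.star_mul_self_eq_zero_iff _ |>.1 (eq_zero_of_matPow_eq_zero hpsd h))

lemma continuousOn_Daz_kappaDomain {κ : ℝ} (hκ : 0 < κ) {f : ℝ → ℝ}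
    (hf : IsKappaFunction κ f) :
    ContinuousOn (fun x : ℝ × ℝ × Matrix ι ι ℂ × Matrix ι ι ℂ => Daz x.1 x.2.1 x.2.2.1 x.2.2.2)
      (kappaDomain ι κ f) := by
  have hf0 : f 0 = 0 := by
    obtain ⟨M, -, hM⟩ := exists_bound_of_isKappaFunction (R := 0) hκ hf
    refine le_antisymm ?_ (hf.2.1 0 self_mem_Ici)
    simpa [Real.zero_rpow hκ.ne'] using hM 0 ⟨le_rfl, le_rfl⟩
  have hQ := continuousOn_Qaz_kappaDomain (ι := ι) hκ hf
  have hQ0 := fun x (hx : x ∈ kappaDomain ι κ f) => Qaz_ne_zero_of_mem_kappaDomain hκ hf hx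
  have hreal : ContinuousOn (fun x : ℝ × ℝ × Matrix ι ι ℂ × Matrix ι ι ℂ =>
      (x.1 - 1)⁻¹ * (Real.log (Qaz x.1 x.2.1 x.2.2.1 x.2.2.2) - Real.log (reTrace x.2.2.1)))
      (kappaDomain ι κ f) := by
    refine ContinuousOn.mul (ContinuousOn.inv₀ (by fun_prop) fun x hx => (sub_pos.2 hx.1).ne')
      ((hQ.log hQ0).sub (ContinuousOn.log (continuousOn_reTrace_comp (by fun_prop)) ?_))
    exact fun x hx => reTrace_ne_zero hx.2.2.2.2.1.1 hx.2.2.2.2.1.2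
  refine (continuous_coe_real_ereal.comp_continuousOn hreal).congr fun x hx => ?_
  exact if_pos ⟨Or.inl (suppLE_of_le_hermApply hx.2.2.2.2.1.1 hx.2.2.2.2.2.1.1 hf0
    hx.2.2.2.2.2.2), hQ0 x hx⟩

end Auxiliary

/-- For a `κ`-function `f`, `(α, z, ρ, σ) ↦ D_{α,z}(ρ‖σ)` is continuous
on `{(α,z) : α > 1, (1-κ)α < 1, (α-1)/κ < z} × {(ρ,σ) : nonzero PSD, ρ ≤ f(σ)}`. -/
theorem renyi_az_continuousOn_of_kappaFunction {n : ℕ} (κ : ℝ) (hκ : 0 < κ)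
    (f : ℝ → ℝ) (hf : IsKappaFunction κ f) :
    ContinuousOn
      (fun x : ℝ × ℝ × Matrix (Fin n) (Fin n) ℂ × Matrix (Fin n) (Fin n) ℂ =>
        Daz x.1 x.2.1 x.2.2.1 x.2.2.2)
      {x : ℝ × ℝ × Matrix (Fin n) (Fin n) ℂ × Matrix (Fin n) (Fin n) ℂ |
        1 < x.1 ∧ 0 < x.2.1 ∧ (1 - κ) * x.1 < 1 ∧ (x.1 - 1) / κ < x.2.1 ∧
        PSDne x.2.2.1 ∧ PSDne x.2.2.2 ∧
        loewnerLE x.2.2.1 (hermApply f x.2.2.2)} := by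
  exact continuousOn_Daz_kappaDomain hκ hf

end QRenyi

end
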